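/- Choose an edge ℓ ∈ E_G; for each (T,p) ∈ 𝒯_G*, choose a set 𝒞(T,p) ⊆ 𝒥(T,p) of representatives of the equivalence classes of ∼ on 𝒥(T,p), and choose K(T,p) ∈ 𝒞(T,p). Then the set {t_e² − t_ℓ² : e ∈ E_G, e ≠ ℓ} ∪ ⋃_{(T,p) ∈ 𝒯_G*} {t_J − t_{K(T,p)} : J ∈ 𝒞(T,p), J ≠ K(T,p)} is a minimal homogeneous generating set of I(G). -/

import Mathlib

open MvPolynomial Finset

variable {n : ℕ}

/-- The monomial `x_i * x_j` attached to an edge `{i,j}`. -/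
noncomputable def edgeMono (K : Type*) [Field K] (e : Sym2 (Fin n)) :
    MvPolynomial (Fin n) K :=
  Sym2.lift ⟨fun i j => X i * X j, fun _ _ => mul_comm _ _⟩ e

/-- The map `φ : K[E_G] → K[x_1,…,x_n]`, `t_e ↦ x_i x_j` for `e = {i,j}`. -/
noncomputable def phiG (K : Type*) [Field K] (G : SimpleGraph (Fin n)) :
    MvPolynomial G.edgeSet K →ₐ[K] MvPolynomial (Fin n) K :=
  aeval (fun e => edgeMono K e.1)

/-- The Eulerian ideal `I(G) = φ⁻¹(x_i² - x_j² : i, j)`. -/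
noncomputable def eulerianIdeal (K : Type*) [Field K] (G : SimpleGraph (Fin n)) :
    Ideal (MvPolynomial G.edgeSet K) :=
  Ideal.comap (phiG K G) (Ideal.span {f | ∃ i j : Fin n, f = X i ^ 2 - X j ^ 2})

/-- `deg_J(i)`: the number of edges of `J` containing the vertex `i`. -/
def degIn (G : SimpleGraph (Fin n)) (J : Finset G.edgeSet) (i : Fin n) : ℕ :=
  (J.filter fun e => i ∈ e.val).card

/-- A set of edges is Eulerian if every vertex has even degree in it. -/
def IsEulerianSet (G : SimpleGraph (Fin n)) (C : Finset G.edgeSet) : Prop :=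
  ∀ i : Fin n, Even (degIn G C i)

/-- `J` is a `T`-join. -/
def IsTJoin (G : SimpleGraph (Fin n)) (T : Finset (Fin n)) (J : Finset G.edgeSet) : Prop :=
  ∀ i : Fin n, i ∈ T ↔ Odd (degIn G J i)

/-- `J` is a `(T,p)`-join. -/
def IsTPJoin (G : SimpleGraph (Fin n)) (T : Finset (Fin n)) (p : ZMod 2)
    (J : Finset G.edgeSet) : Prop :=
  IsTJoin G T J ∧ (J.card : ZMod 2) = p

/-- `(T,p) ∈ 𝒯_G`: there exists a `(T,p)`-join. -/
def JoinExists (G : SimpleGraph (Fin n)) (T : Finset (Fin n)) (p : ZMod 2) : Prop :=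
  ∃ J : Finset G.edgeSet, IsTPJoin G T p J

/-- `J ∈ 𝒥(T,p)`: `J` is a `(T,p)`-join of minimum cardinality. -/
def IsMinJoin (G : SimpleGraph (Fin n)) (T : Finset (Fin n)) (p : ZMod 2)
    (J : Finset G.edgeSet) : Prop :=
  IsTPJoin G T p J ∧ ∀ J' : Finset G.edgeSet, IsTPJoin G T p J' → J.card ≤ J'.card

/-- The equivalence relation `∼` on minimum cardinality `(T,p)`-joins. -/
def JoinEquiv (G : SimpleGraph (Fin n)) (T : Finset (Fin n)) (p : ZMod 2)
    (J K : Finset G.edgeSet) : Prop :=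
  ∃ (r : ℕ) (L : ℕ → Finset G.edgeSet), L 0 = J ∧ L r = K ∧
    (∀ i ≤ r, IsMinJoin G T p (L i)) ∧ ∀ i < r, (L i ∩ L (i + 1)).Nonempty

/-- `(T,p) ∈ 𝒯_G*`: there are two nonequivalent minimum cardinality `(T,p)`-joins. -/
def TGstar (G : SimpleGraph (Fin n)) (T : Finset (Fin n)) (p : ZMod 2) : Prop :=
  ∃ J K : Finset G.edgeSet, IsMinJoin G T p J ∧ IsMinJoin G T p K ∧ ¬ JoinEquiv G T p J K

/-- `t_J`, the product of the variables indexed by the edges of `J`. -/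
noncomputable def tMon (K : Type*) [Field K] (G : SimpleGraph (Fin n))
    (J : Finset G.edgeSet) : MvPolynomial G.edgeSet K :=
  ∏ e ∈ J, X e

/-- The vertex set of a set of edges. -/
def edgeVerts (G : SimpleGraph (Fin n)) (C : Finset G.edgeSet) : Finset (Fin n) :=
  Finset.univ.filter fun i => ∃ e ∈ C, i ∈ e.val

/-- `C` is the edge set of a cycle of `G`. -/
def IsCycleSet (G : SimpleGraph (Fin n)) (C : Finset G.edgeSet) : Prop :=
  ∃ (v : Fin n) (w : G.Walk v v), w.IsCycle ∧
    C.image (fun e => e.val) = w.edges.toFinset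

/-- A chord of a cycle `C`: an edge of `G` joining two nonadjacent vertices of `C`. -/
def IsChord (G : SimpleGraph (Fin n)) (C : Finset G.edgeSet) (l : G.edgeSet) : Prop :=
  l ∉ C ∧ ∀ i ∈ l.val, i ∈ edgeVerts G C

/-- An even-chord of an even cardinality Eulerian set `C`. -/
def IsEvenChord (G : SimpleGraph (Fin n)) (C : Finset G.edgeSet) (l : G.edgeSet) : Prop :=
  l ∉ C ∧ ∃ C₁ C₂ : Finset G.edgeSet,
    IsEulerianSet G C₁ ∧ Even C₁.card ∧ IsEulerianSet G C₂ ∧ Even C₂.card ∧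
    C₁ ∩ C₂ = {l} ∧ C = symmDiff C₁ C₂

/-- `S` is a minimal homogeneous generating set of the ideal `I`. -/
def IsMinimalHomGenSet {σ K : Type*} [Field K] (S : Set (MvPolynomial σ K))
    (I : Ideal (MvPolynomial σ K)) : Prop :=
  (∀ f ∈ S, ∃ d : ℕ, f.IsHomogeneous d) ∧ Ideal.span S = I ∧
    ∀ f ∈ S, Ideal.span (S \ {f}) ≠ I

section MonomialMap

variable {σ K M : Type*} [Field K] [AddCommGroup M] [Module K M]

/-- The linear map sending the monomial with exponent `m` to `F m`. -/
noncomputable def monomialMap (K : Type*) [Field K] [Module K M] (F : (σ →₀ ℕ) → M) :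
    MvPolynomial σ K →ₗ[K] M :=
  (MvPolynomial.basisMonomials σ K).constr K F

theorem monomialMap_monomial (F : (σ →₀ ℕ) → M) (m : σ →₀ ℕ) :
    monomialMap K F (monomial m 1) = F m := by
  have h := (MvPolynomial.basisMonomials σ K).constr_basis K F m
  rwa [MvPolynomial.coe_basisMonomials] at h

/-- A linear map vanishing on all monomial multiples of the binomials in `S` vanishes on the ideal
generated by `S`. -/
theorem monomialMap_eq_zero_of_mem_span {S : Set (MvPolynomial σ K)} (F : (σ →₀ ℕ) → M)
    (hS : ∀ g ∈ S, ∃ u v : σ →₀ ℕ, g = monomial u 1 - monomial v 1 ∧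
      ∀ a, F (a + u) = F (a + v))
    {f : MvPolynomial σ K} (hf : f ∈ Ideal.span S) : monomialMap K F f = 0 := by
  suffices h : ∀ r : MvPolynomial σ K, monomialMap K F (r * f) = 0 by simpa using h 1
  induction hf using Submodule.span_induction with
  | mem g hg =>
    obtain ⟨u, v, rfl, h⟩ := hS g hg
    intro r
    induction r using MvPolynomial.induction_on' with
    | monomial a c =>
      have hc : (monomial a c : MvPolynomial σ K) = c • monomial a 1 := by
        rw [smul_monomial, smul_eq_mul, mul_one]
      rw [hc, smul_mul_assoc, map_smul, mul_sub, monomial_mul, monomial_mul, mul_one, map_sub,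
        monomialMap_monomial, monomialMap_monomial, h, sub_self, smul_zero]
    | add p q hp hq => rw [add_mul, map_add, hp, hq, add_zero]
  | zero => simp
  | add f g _ _ hf hg => intro r; rw [mul_add, map_add, hf, hg, add_zero]
  | smul s g _ hg => intro r; rw [smul_eq_mul, ← mul_assoc, hg]

/-- A binomial separated by a set `A` of exponents does not lie in an ideal generated by binomials
none of whose monomial multiples is separated by `A`. -/
theorem notMem_span_of_separated {S : Set (MvPolynomial σ K)} (A : Set (σ →₀ ℕ))
    (hS : ∀ g ∈ S, ∃ u v : σ →₀ ℕ, g = monomial u 1 - monomial v 1 ∧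
      ∀ a, a + u ∈ A ↔ a + v ∈ A)
    {u v : σ →₀ ℕ} (hu : u ∈ A) (hv : v ∉ A) :
    (monomial u 1 - monomial v 1 : MvPolynomial σ K) ∉ Ideal.span S := by
  classical
  intro h
  have h0 := monomialMap_eq_zero_of_mem_span (M := K) (fun m => if m ∈ A then (1 : K) else 0)
    (fun g hg => by
      obtain ⟨u, v, hg, h⟩ := hS g hg
      exact ⟨u, v, hg, fun a => by simp only [h a]⟩) h
  simp [monomialMap_monomial, hu, hv] at h0

end MonomialMap

section VertexClass

/-- The degree of an exponent vector together with its entries modulo two. -/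
noncomputable def vertexClass (n : ℕ) : (Fin n →₀ ℕ) →+ ℕ × (Fin n → ZMod 2) where
  toFun a := (a.degree, fun i => (a i : ZMod 2))
  map_zero' := by ext <;> simp
  map_add' a b := by ext <;> simp

theorem monomial_sub_monomial_mem_of_vertexClass_eq (K : Type*) [Field K] {a b : Fin n →₀ ℕ}
    (h : vertexClass n a = vertexClass n b) :
    (monomial a 1 - monomial b 1 : MvPolynomial (Fin n) K) ∈
      Ideal.span {f | ∃ i j : Fin n, f = X i ^ 2 - X j ^ 2} := by
  rcases isEmpty_or_nonempty (Fin n) with hn | ⟨⟨v⟩⟩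
  · simp [Subsingleton.elim a b]
  set I : Ideal (MvPolynomial (Fin n) K) := Ideal.span {f | ∃ i j : Fin n, f = X i ^ 2 - X j ^ 2}
  have hsq (i : Fin n) : Ideal.Quotient.mk I (X i) ^ 2 = Ideal.Quotient.mk I (X v) ^ 2 := by
    rw [← map_pow, ← map_pow, Ideal.Quotient.eq]
    exact Ideal.subset_span ⟨i, v, rfl⟩
  have hnf (c : Fin n →₀ ℕ) : Ideal.Quotient.mk I (monomial c 1) =
      (∏ i, Ideal.Quotient.mk I (X i) ^ (c i % 2)) *
        (Ideal.Quotient.mk I (X v) ^ 2) ^ (∑ i, c i / 2) := by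
    rw [monomial_eq, C_1, one_mul, Finsupp.prod_fintype _ _ (by simp), map_prod,
      ← Finset.prod_pow_eq_pow_sum, ← Finset.prod_mul_distrib]
    refine Finset.prod_congr rfl fun i _ => ?_
    rw [← hsq i, ← pow_mul, ← pow_add, Nat.mod_add_div, map_pow]
  have hmod (i : Fin n) : a i % 2 = b i % 2 :=
    (ZMod.natCast_eq_natCast_iff' _ _ _).1 (congrFun (congrArg Prod.snd h) i)
  have hdeg : ∑ i, a i = ∑ i, b i := by
    rw [← Finsupp.degree_eq_sum, ← Finsupp.degree_eq_sum]
    exact congrArg Prod.fst h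
  have hsplit (c : Fin n →₀ ℕ) : ∑ i, c i = ∑ i, c i % 2 + 2 * ∑ i, c i / 2 := by
    rw [Finset.mul_sum, ← Finset.sum_add_distrib]
    exact Finset.sum_congr rfl fun i _ => (Nat.mod_add_div _ _).symm
  have hdiv : ∑ i, a i / 2 = ∑ i, b i / 2 := by
    have ha := hsplit a
    have hb := hsplit b
    simp only [hmod] at ha
    omega
  rw [← Ideal.Quotient.eq, hnf a, hnf b, hdiv]
  simp only [hmod]

end VertexClass

section JoinClass

variable {G : SimpleGraph (Fin n)}

/-- The degree of a monomial in the edge variables together with the parities of the vertex degrees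
of the corresponding multiset of edges. -/
noncomputable def joinClass (G : SimpleGraph (Fin n)) : (G.edgeSet →₀ ℕ) →+ ℕ × (Fin n → ZMod 2) :=
  Finsupp.liftAddHom fun e => multiplesHom _ (1, fun i => if i ∈ e.1 then 1 else 0)

theorem joinClass_single (e : G.edgeSet) (k : ℕ) :
    joinClass G (Finsupp.single e k) = k • (1, fun i => if i ∈ e.1 then 1 else 0) := by
  simp [joinClass]

theorem two_nsmul_parity {ι : Type*} (c : ι → ZMod 2) : 2 • c = 0 := by
  ext i
  simpa [two_mul] using CharTwo.add_self_eq_zero (c i)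

theorem joinClass_two_nsmul (m : G.edgeSet →₀ ℕ) :
    joinClass G (2 • m) = (2 * (joinClass G m).1, 0) := by
  rw [map_nsmul]
  exact Prod.ext (by simp) (two_nsmul_parity _)

theorem joinClass_single_two (e : G.edgeSet) : joinClass G (Finsupp.single e 2) = (2, 0) := by
  rw [joinClass_single]
  exact Prod.ext (by simp) (two_nsmul_parity _)

theorem joinClass_fst (m : G.edgeSet →₀ ℕ) : (joinClass G m).1 = m.degree := by
  induction m using Finsupp.induction_linear with
  | zero => simp
  | add f g hf hg => simp [hf, hg]
  | single e k => simp [joinClass_single]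

/-- The image of a monomial under `φ` is a monomial whose class is determined by `joinClass`. -/
theorem exists_phiG_monomial (K : Type*) [Field K] (m : G.edgeSet →₀ ℕ) :
    ∃ a : Fin n →₀ ℕ, phiG K G (monomial m 1) = monomial a 1 ∧
      vertexClass n a = (2 * (joinClass G m).1, (joinClass G m).2) := by
  induction m using Finsupp.induction_linear with
  | zero => exact ⟨0, by simp [show (monomial 0 : K →ₗ[K] MvPolynomial G.edgeSet K) 1 = 1 from rfl,
      show (monomial 0 : K →ₗ[K] MvPolynomial (Fin n) K) 1 = 1 from rfl], by simp; rfl⟩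
  | add f g hf hg =>
    obtain ⟨a, ha, ha'⟩ := hf
    obtain ⟨b, hb, hb'⟩ := hg
    refine ⟨a + b, ?_, ?_⟩
    · rw [← mul_one (1 : K), ← monomial_mul, map_mul, ha, hb, monomial_mul]
    · rw [map_add, ha', hb', map_add]
      simp [mul_add]
  | single e k =>
    obtain ⟨a, ha, ha'⟩ : ∃ a : Fin n →₀ ℕ, edgeMono K e.1 = monomial a 1 ∧
        vertexClass n a = (2, fun i => if i ∈ e.1 then 1 else 0) := by
      obtain ⟨e, he⟩ := e
      induction e using Sym2.ind with
      | _ i j =>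
      have hij : i ≠ j := G.ne_of_adj he
      refine ⟨Finsupp.single i 1 + Finsupp.single j 1, ?_, ?_⟩
      · simp [edgeMono, X, monomial_mul]
      · refine Prod.ext (by simp [vertexClass]) (funext fun k => ?_)
        by_cases hi : k = i
        · subst hi; simp [vertexClass, Finsupp.single_apply, hij.symm]
        · by_cases hj : k = j
          · subst hj; simp [vertexClass, Finsupp.single_apply, hij]
          · simp [vertexClass, Finsupp.single_apply, hi, hj, Ne.symm hi, Ne.symm hj]
    refine ⟨k • a, ?_, ?_⟩
    · rw [phiG, aeval_monomial, map_one, one_mul, Finsupp.prod_single_index (by simp), ha,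
        monomial_pow, one_pow]
    · rw [map_nsmul, ha', joinClass_single]
      ext <;> simp [mul_comm]

theorem monomial_sub_monomial_mem_eulerianIdeal (K : Type*) [Field K] {m m' : G.edgeSet →₀ ℕ}
    (h : joinClass G m = joinClass G m') :
    monomial m 1 - monomial m' 1 ∈ eulerianIdeal K G := by
  obtain ⟨a, ha, ha'⟩ := exists_phiG_monomial K m
  obtain ⟨b, hb, hb'⟩ := exists_phiG_monomial K m'
  rw [eulerianIdeal, Ideal.mem_comap, map_sub, ha, hb]
  exact monomial_sub_monomial_mem_of_vertexClass_eq K (by rw [ha', hb', h])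

/-- An ideal identifying all monomials of the same class contains the Eulerian ideal. -/
theorem eulerianIdeal_le_of_forall_joinClass {K : Type*} [Field K]
    {I : Ideal (MvPolynomial G.edgeSet K)}
    (hI : ∀ m m', joinClass G m = joinClass G m' →
      Ideal.Quotient.mk I (monomial m 1) = Ideal.Quotient.mk I (monomial m' 1)) :
    eulerianIdeal K G ≤ I := by
  classical
  let F : (Fin n →₀ ℕ) → MvPolynomial G.edgeSet K ⧸ I := fun a =>
    if h : ∃ m, vertexClass n a = (2 * (joinClass G m).1, (joinClass G m).2) then
      Ideal.Quotient.mk I (monomial h.choose 1) else 0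
  have hF {a b : Fin n →₀ ℕ} (h : vertexClass n a = vertexClass n b) : F a = F b := by
    simp only [F, h]
  have hcomp : (monomialMap K F).comp (phiG K G).toLinearMap =
      (Ideal.Quotient.mkₐ K I).toLinearMap := by
    refine (MvPolynomial.basisMonomials G.edgeSet K).ext fun m => ?_
    obtain ⟨a, ha, ha'⟩ := exists_phiG_monomial K m
    have hex : ∃ m, vertexClass n a = (2 * (joinClass G m).1, (joinClass G m).2) := ⟨m, ha'⟩
    have hFa : F a = Ideal.Quotient.mk I (monomial hex.choose 1) := dif_pos hex
    have hcl := ha'.symm.trans hex.choose_spec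
    rw [Prod.mk.injEq] at hcl
    rw [MvPolynomial.coe_basisMonomials, LinearMap.comp_apply, AlgHom.toLinearMap_apply, ha,
      monomialMap_monomial, hFa]
    exact hI _ _ (Prod.ext (by omega) hcl.2.symm)
  intro f hf
  have h0 : monomialMap K F (phiG K G f) = 0 := by
    refine monomialMap_eq_zero_of_mem_span F ?_ hf
    rintro g ⟨i, j, rfl⟩
    refine ⟨Finsupp.single i 2, Finsupp.single j 2, by simp [X_pow_eq_monomial], fun a => hF ?_⟩
    rw [map_add, map_add]
    congr 1
    have h2 (i : Fin n) : vertexClass n (Finsupp.single i 2) = (2, 0) := by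
      refine Prod.ext (by simp [vertexClass]) (funext fun k => ?_)
      by_cases h : i = k
      · subst h; simpa [vertexClass] using CharTwo.two_eq_zero
      · simp [vertexClass, Finsupp.single_apply, h]
    rw [h2, h2]
  have h1 := LinearMap.congr_fun hcomp f
  rw [LinearMap.comp_apply, AlgHom.toLinearMap_apply, h0] at h1
  exact Ideal.Quotient.eq_zero_iff_mem.1 h1.symm

end JoinClass

section Joins

variable {G : SimpleGraph (Fin n)} {T : Finset (Fin n)} {p : ZMod 2}

/-- The exponent vector of the squarefree monomial `t_J`. -/
noncomputable def joinExp (J : Finset G.edgeSet) : G.edgeSet →₀ ℕ :=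
  ∑ e ∈ J, Finsupp.single e 1

theorem tMon_eq_monomial (K : Type*) [Field K] (J : Finset G.edgeSet) :
    tMon K G J = monomial (joinExp J) 1 := by
  rw [joinExp, monomial_sum_one, tMon]
  rfl

theorem joinExp_apply (J : Finset G.edgeSet) (e : G.edgeSet) :
    joinExp J e = if e ∈ J then 1 else 0 := by
  simp [joinExp, Finsupp.finsetSum_apply, Finsupp.single_apply]

theorem mem_iff_joinExp_ne_zero {J : Finset G.edgeSet} {e : G.edgeSet} :
    e ∈ J ↔ joinExp J e ≠ 0 := by
  simp [joinExp_apply]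

theorem joinExp_injective : Function.Injective (joinExp (G := G)) := by
  intro J J' h
  ext e
  rw [mem_iff_joinExp_ne_zero, h, mem_iff_joinExp_ne_zero]

theorem joinClass_joinExp (J : Finset G.edgeSet) :
    joinClass G (joinExp J) = (J.card, fun i => (degIn G J i : ZMod 2)) := by
  simp only [joinExp, map_sum, joinClass_single, one_smul]
  refine Prod.ext (by simp [Prod.fst_sum]) (funext fun i => ?_)
  simp [Prod.snd_sum, Finset.sum_apply, degIn]

theorem IsTPJoin.joinClass_snd {J : Finset G.edgeSet} (hJ : IsTPJoin G T p J) :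
    (joinClass G (joinExp J)).2 = fun i => if i ∈ T then 1 else 0 := by
  rw [joinClass_joinExp]
  funext i
  by_cases hi : i ∈ T
  · simpa [hi, ZMod.natCast_eq_one_iff_odd] using (hJ.1 i).1 hi
  · simpa [hi, ZMod.natCast_eq_zero_iff_even] using fun h => hi ((hJ.1 i).2 h)

theorem isTPJoin_of_joinClass_snd {J : Finset G.edgeSet}
    (h : (joinClass G (joinExp J)).2 = fun i => if i ∈ T then 1 else 0)
    (hp : (J.card : ZMod 2) = p) : IsTPJoin G T p J := by
  refine ⟨fun i => ?_, hp⟩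
  rw [joinClass_joinExp] at h
  have hi := congrFun h i
  rw [← ZMod.natCast_eq_one_iff_odd]
  simp only at hi
  rw [hi]
  simp

/-- The vertices of odd degree in `J`. -/
def oddVerts (J : Finset G.edgeSet) : Finset (Fin n) :=
  Finset.univ.filter fun i => Odd (degIn G J i)

theorem isTPJoin_oddVerts (J : Finset G.edgeSet) :
    IsTPJoin G (oddVerts J) (J.card : ZMod 2) J :=
  ⟨fun i => by simp [oddVerts], rfl⟩

theorem IsTPJoin.unique {T' : Finset (Fin n)} {p' : ZMod 2} {J : Finset G.edgeSet}
    (h : IsTPJoin G T p J) (h' : IsTPJoin G T' p' J) : T' = T ∧ p' = p :=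
  ⟨Finset.ext fun i => (h'.1 i).trans (h.1 i).symm, h'.2.symm.trans h.2⟩

theorem IsMinJoin.card_eq {J J' : Finset G.edgeSet} (hJ : IsMinJoin G T p J)
    (hJ' : IsMinJoin G T p J') : J.card = J'.card :=
  le_antisymm (hJ.2 _ hJ'.1) (hJ'.2 _ hJ.1)

theorem IsMinJoin.joinClass_eq {J J' : Finset G.edgeSet} (hJ : IsMinJoin G T p J)
    (hJ' : IsMinJoin G T p J') : joinClass G (joinExp J) = joinClass G (joinExp J') := by
  refine Prod.ext ?_ (by rw [hJ.1.joinClass_snd, hJ'.1.joinClass_snd])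
  rw [joinClass_joinExp, joinClass_joinExp]
  exact hJ.card_eq hJ'

theorem IsTPJoin.of_joinClass_eq {J J' : Finset G.edgeSet} (hJ : IsTPJoin G T p J)
    (h : joinClass G (joinExp J') = joinClass G (joinExp J)) : IsTPJoin G T p J' := by
  refine isTPJoin_of_joinClass_snd (by rw [h, hJ.joinClass_snd]) ?_
  have hc := congrArg Prod.fst h
  simp only [joinClass_joinExp] at hc
  rw [hc, hJ.2]

theorem IsMinJoin.of_joinClass_eq {J J' : Finset G.edgeSet} (hJ : IsMinJoin G T p J)
    (h : joinClass G (joinExp J') = joinClass G (joinExp J)) : IsMinJoin G T p J' := by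
  have hc := congrArg Prod.fst h
  simp only [joinClass_joinExp] at hc
  exact ⟨hJ.1.of_joinClass_eq h, fun J₂ h₂ => hc ▸ hJ.2 J₂ h₂⟩

theorem exists_eq_joinExp_add (m : G.edgeSet →₀ ℕ) :
    ∃ (J : Finset G.edgeSet) (q : G.edgeSet →₀ ℕ), m = joinExp J + 2 • q := by
  refine ⟨m.support.filter fun e => Odd (m e), m.mapRange (· / 2) rfl, ?_⟩
  ext e
  have h : (m e ≠ 0 ∧ Odd (m e)) ↔ m e % 2 = 1 := by
    rw [Nat.odd_iff]
    omega
  simp only [Finsupp.add_apply, Finsupp.smul_apply, Finsupp.mapRange_apply, joinExp_apply,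
    Finset.mem_filter, Finsupp.mem_support_iff, h, smul_eq_mul]
  split_ifs <;> omega

theorem joinExp_add_two_nsmul_eq_single_two_add {J : Finset G.edgeSet} {q : G.edgeSet →₀ ℕ}
    (hq : q ≠ 0) : ∃ (e : G.edgeSet) (a : G.edgeSet →₀ ℕ),
      joinExp J + 2 • q = Finsupp.single e 2 + a := by
  obtain ⟨e, he⟩ := Finsupp.ne_iff.1 hq
  have hle : Finsupp.single e 2 ≤ joinExp J + 2 • q := by
    rw [Finsupp.single_le_iff]
    simp only [Finsupp.add_apply, Finsupp.smul_apply, smul_eq_mul, Finsupp.coe_zero,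
      Pi.zero_apply] at he ⊢
    omega
  exact ⟨e, _, (add_tsub_cancel_of_le hle).symm⟩

/-- Every monomial in the class of a minimum cardinality join is squarefree. -/
theorem IsMinJoin.exists_eq_joinExp {J : Finset G.edgeSet} (hJ : IsMinJoin G T p J)
    {m : G.edgeSet →₀ ℕ} (hm : joinClass G m = joinClass G (joinExp J)) :
    ∃ J' : Finset G.edgeSet, m = joinExp J' ∧ IsMinJoin G T p J' := by
  obtain ⟨J', q, rfl⟩ := exists_eq_joinExp_add m
  have h := hm
  rw [map_add, joinClass_two_nsmul, Prod.ext_iff] at h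
  obtain ⟨h₁, h₂⟩ := h
  simp only [Prod.snd_add, add_zero] at h₂
  simp only [Prod.fst_add, joinClass_joinExp] at h₁
  have hJ' : IsTPJoin G T p J' := by
    refine isTPJoin_of_joinClass_snd (by rw [h₂, hJ.1.joinClass_snd]) ?_
    rw [← hJ.1.2, ← h₁, Nat.cast_add, Nat.cast_mul, ZMod.natCast_self, zero_mul, add_zero]
  have hq : q = 0 := by
    have := hJ.2 _ hJ'
    rw [← Finsupp.degree_eq_zero_iff, ← joinClass_fst]
    omega
  subst hq
  rw [smul_zero, add_zero] at hm ⊢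
  exact ⟨J', rfl, hJ.of_joinClass_eq hm⟩

theorem JoinEquiv.refl {J : Finset G.edgeSet} (hJ : IsMinJoin G T p J) : JoinEquiv G T p J J :=
  ⟨0, fun _ => J, rfl, rfl, fun _ _ => hJ, fun _ hi => absurd hi (Nat.not_lt_zero _)⟩

theorem JoinEquiv.isMinJoin_left {J J' : Finset G.edgeSet} (h : JoinEquiv G T p J J') :
    IsMinJoin G T p J := by
  obtain ⟨r, L, h0, -, hL, -⟩ := h
  exact h0 ▸ hL 0 (Nat.zero_le _)

theorem JoinEquiv.head {J J' J₀ : Finset G.edgeSet} (hJ : IsMinJoin G T p J₀)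
    (hne : (J₀ ∩ J).Nonempty) (h : JoinEquiv G T p J J') : JoinEquiv G T p J₀ J' := by
  obtain ⟨r, L, h0, hr, hL, hLi⟩ := h
  refine ⟨r + 1, fun i => Nat.casesOn i J₀ L, rfl, hr, ?_, ?_⟩
  · rintro (_ | i) hi
    · exact hJ
    · exact hL i (by omega)
  · rintro (_ | i) hi
    · subst h0; exact hne
    · exact hLi i (by omega)

/-- A function on minimum cardinality joins that agrees on intersecting ones agrees on equivalent
ones. -/
theorem JoinEquiv.apply_eq {α : Type*} {f : Finset G.edgeSet → α}
    (hf : ∀ J J', IsMinJoin G T p J → IsMinJoin G T p J' → (J ∩ J').Nonempty → f J = f J')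
    {J J' : Finset G.edgeSet} (h : JoinEquiv G T p J J') : f J = f J' := by
  obtain ⟨r, L, rfl, rfl, hL, hLi⟩ := h
  have key : ∀ i ≤ r, f (L 0) = f (L i) := by
    intro i
    induction i with
    | zero => simp
    | succ i ih =>
      intro hi
      exact (ih (by omega)).trans (hf _ _ (hL i (by omega)) (hL _ hi) (hLi i (by omega)))
  exact key r le_rfl

/-- Adding a common exponent preserves being a join equivalent to a given one. -/
theorem JoinEquiv.exists_add_joinExp {J J₁ J₂ : Finset G.edgeSet} {a : G.edgeSet →₀ ℕ}
    (h₁₂ : joinClass G (joinExp J₁) = joinClass G (joinExp J₂)) (ha : a ≠ 0)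
    (h : ∃ L, JoinEquiv G T p L J ∧ a + joinExp J₁ = joinExp L) :
    ∃ L, JoinEquiv G T p L J ∧ a + joinExp J₂ = joinExp L := by
  obtain ⟨L, hL, hLa⟩ := h
  obtain ⟨L', hL', hmin⟩ := hL.isMinJoin_left.exists_eq_joinExp (m := a + joinExp J₂)
    (by rw [← hLa, map_add, map_add, h₁₂])
  refine ⟨L', hL.head hmin ?_, hL'⟩
  obtain ⟨e, he⟩ := Finsupp.ne_iff.1 ha
  rw [Finsupp.coe_zero, Pi.zero_apply] at he
  refine ⟨e, Finset.mem_inter.2 ⟨?_, ?_⟩⟩ <;> rw [mem_iff_joinExp_ne_zero]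
  · rw [← hL', Finsupp.add_apply]
    omega
  · rw [← hLa, Finsupp.add_apply]
    omega

/-- Two joins of the same class with at most one edge coincide. -/
theorem eq_of_joinClass_eq_of_card_le_one {J J' : Finset G.edgeSet}
    (h : joinClass G (joinExp J) = joinClass G (joinExp J')) (hJ : J.card ≤ 1) : J = J' := by
  have hc := congrArg Prod.fst h
  simp only [joinClass_joinExp] at hc
  rcases Nat.le_one_iff_eq_zero_or_eq_one.1 hJ with h0 | h1
  · rw [Finset.card_eq_zero.1 h0, Finset.card_eq_zero.1 (hc.symm.trans h0)]
  · obtain ⟨e, rfl⟩ := Finset.card_eq_one.1 h1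
    obtain ⟨e', rfl⟩ := Finset.card_eq_one.1 (hc.symm.trans h1)
    congr 1
    refine Subtype.ext (Sym2.ext fun i => ?_)
    have hi := congrFun (congrArg Prod.snd h) i
    simp only [joinExp, Finset.sum_singleton, joinClass_single, one_smul] at hi
    by_cases h₁ : i ∈ e.1 <;> by_cases h₂ : i ∈ e'.1 <;> simp_all

end Joins

section Generation

variable {K : Type*} [Field K] {G : SimpleGraph (Fin n)}

/-- An ideal containing the differences of squares of variables and identifying nonequivalent
minimum cardinality joins identifies all monomials of the same class. -/
theorem mk_monomial_eq_of_joinClass_eq {I : Ideal (MvPolynomial G.edgeSet K)}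
    {l : G.edgeSet} (hsq : ∀ e : G.edgeSet, Ideal.Quotient.mk I (monomial (Finsupp.single e 2) 1) =
      Ideal.Quotient.mk I (monomial (Finsupp.single l 2) 1))
    (hjoin : ∀ T p, TGstar G T p → ∃ c, ∀ J, IsMinJoin G T p J →
      ∃ J', JoinEquiv G T p J J' ∧ Ideal.Quotient.mk I (monomial (joinExp J') 1) = c)
    (m m' : G.edgeSet →₀ ℕ) (h : joinClass G m = joinClass G m') :
    Ideal.Quotient.mk I (monomial m 1) = Ideal.Quotient.mk I (monomial m' 1) := by
  obtain ⟨d, hd⟩ : ∃ d, m.degree = d := ⟨_, rfl⟩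
  induction d using Nat.strong_induction_on generalizing m m' with
  | _ d ih =>
  have hmul (a b : G.edgeSet →₀ ℕ) : Ideal.Quotient.mk I (monomial (a + b) 1) =
      Ideal.Quotient.mk I (monomial a 1) * Ideal.Quotient.mk I (monomial b 1) := by
    rw [← map_mul, monomial_mul, mul_one]
  have hcommon (m m' : G.edgeSet →₀ ℕ) (h : joinClass G m = joinClass G m')
      (hd : m.degree = d) (e : G.edgeSet) (he : m e ≠ 0) (he' : m' e ≠ 0) :
      Ideal.Quotient.mk I (monomial m 1) = Ideal.Quotient.mk I (monomial m' 1) := by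
    obtain ⟨a, rfl⟩ := exists_add_of_le
      (Finsupp.single_le_iff.2 (Nat.one_le_iff_ne_zero.2 he))
    obtain ⟨a', rfl⟩ := exists_add_of_le
      (Finsupp.single_le_iff.2 (Nat.one_le_iff_ne_zero.2 he'))
    rw [map_add, map_add, add_right_inj] at h
    rw [map_add, Finsupp.degree_single] at hd
    rw [hmul, hmul, ih a.degree (by omega) a a' h rfl]
  have hsquare (m m' : G.edgeSet →₀ ℕ) (h : joinClass G m = joinClass G m')
      (hd : m.degree = d) (e : G.edgeSet) (a : G.edgeSet →₀ ℕ)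
      (hm : m = Finsupp.single e 2 + a) :
      Ideal.Quotient.mk I (monomial m 1) = Ideal.Quotient.mk I (monomial m' 1) := by
    subst hm
    have hm' : m' ≠ 0 := by
      rintro rfl
      have := congrArg Prod.fst h
      rw [joinClass_fst, joinClass_fst, map_add, Finsupp.degree_single, map_zero] at this
      omega
    obtain ⟨e', he'⟩ := Finsupp.ne_iff.1 hm'
    rw [hmul, hsq e, ← hsq e', ← hmul]
    refine hcommon _ _ ?_ ?_ e' (by simp) he'
    · rw [← h, map_add, map_add, joinClass_single_two, joinClass_single_two]
    · rw [← hd, map_add, map_add, Finsupp.degree_single, Finsupp.degree_single]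
  have hd' : m'.degree = d := by rw [← hd, ← joinClass_fst, ← joinClass_fst, h]
  obtain ⟨J, q, rfl⟩ := exists_eq_joinExp_add m
  by_cases hq : q ≠ 0
  · obtain ⟨e, a, ha⟩ := joinExp_add_two_nsmul_eq_single_two_add (J := J) hq
    exact hsquare _ _ h hd e a ha
  obtain ⟨J', q', rfl⟩ := exists_eq_joinExp_add m'
  by_cases hq' : q' ≠ 0
  · obtain ⟨e, a, ha⟩ := joinExp_add_two_nsmul_eq_single_two_add (J := J') hq'
    exact (hsquare _ _ h.symm hd' e a ha).symm
  simp only [not_not] at hq hq'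
  subst hq hq'
  simp only [smul_zero, add_zero] at h hd hd' ⊢
  have hdJ : J.card = d := by rw [← hd, ← joinClass_fst, joinClass_joinExp]
  have hJ := isTPJoin_oddVerts J
  by_cases hmin : IsMinJoin G (oddVerts J) (J.card : ZMod 2) J
  · have hmin' := hmin.of_joinClass_eq h.symm
    have hequiv {J₁ J₂ : Finset G.edgeSet}
        (h₁₂ : JoinEquiv G (oddVerts J) (J.card : ZMod 2) J₁ J₂) :
        Ideal.Quotient.mk I (monomial (joinExp J₁) 1) =
          Ideal.Quotient.mk I (monomial (joinExp J₂) 1) := by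
      refine h₁₂.apply_eq (f := fun L => Ideal.Quotient.mk I (monomial (joinExp L) 1)) ?_
      rintro L L' hL hL' ⟨e, he⟩
      rw [Finset.mem_inter] at he
      refine hcommon _ _ (hL.joinClass_eq hL') ?_ e (mem_iff_joinExp_ne_zero.1 he.1)
        (mem_iff_joinExp_ne_zero.1 he.2)
      rw [← hd, ← joinClass_fst, ← joinClass_fst, hL.joinClass_eq hmin]
    by_cases hstar : TGstar G (oddVerts J) (J.card : ZMod 2)
    · obtain ⟨c, hc⟩ := hjoin _ _ hstar
      obtain ⟨J₁, h₁, h₁c⟩ := hc J hmin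
      obtain ⟨J₂, h₂, h₂c⟩ := hc J' hmin'
      rw [hequiv h₁, hequiv h₂, h₁c, h₂c]
    · by_contra hne
      exact hstar ⟨J, J', hmin, hmin', fun h => hne (hequiv h)⟩
  · simp only [IsMinJoin, hJ, true_and, not_forall, not_le] at hmin
    obtain ⟨L, hL, hlt⟩ := hmin
    have hpar : ∃ b, J.card = L.card + 2 * b ∧ b ≠ 0 := by
      have := (ZMod.natCast_eq_natCast_iff' _ _ _).1 hL.2
      exact ⟨(J.card - L.card) / 2, by omega, by omega⟩
    obtain ⟨b, hb, hb0⟩ := hpar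
    have hcl : joinClass G (joinExp L + 2 • Finsupp.single l b) = joinClass G (joinExp J) := by
      rw [map_add, joinClass_two_nsmul]
      refine Prod.ext ?_ (by simp [hL.joinClass_snd, hJ.joinClass_snd])
      simp [joinClass_joinExp, joinClass_single, hb]
    obtain ⟨e, a, ha⟩ := joinExp_add_two_nsmul_eq_single_two_add (J := L)
      (q := Finsupp.single l b) (by simpa using hb0)
    have hdL : (joinExp L + 2 • Finsupp.single l b).degree = d := by
      rw [← joinClass_fst, hcl, joinClass_fst, hd]
    rw [← hsquare _ _ hcl hdL e a ha, hsquare _ _ (hcl.trans h) hdL e a ha]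

end Generation

/-- choosing an edge `ℓ`, a set `𝒞(T,p)` of representatives of the
equivalence classes of `∼` on `𝒥(T,p)` for each `(T,p) ∈ 𝒯_G*`, and `K(T,p) ∈ 𝒞(T,p)`,
the set `{t_e² − t_ℓ² : e ≠ ℓ} ∪ ⋃ {t_J − t_{K(T,p)} : J ∈ 𝒞(T,p), J ≠ K(T,p)}` is a
minimal homogeneous generating set of `I(G)`. -/
theorem stmt5 {n : ℕ} (K : Type*) [Field K] (G : SimpleGraph (Fin n))
    (hE : 2 ≤ G.edgeSet.ncard) (l : G.edgeSet)
    (CS : Finset (Fin n) → ZMod 2 → Set (Finset G.edgeSet))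
    (K0 : Finset (Fin n) → ZMod 2 → Finset G.edgeSet)
    (hCSmem : ∀ T p, TGstar G T p → ∀ J ∈ CS T p, IsMinJoin G T p J)
    (hCSrep : ∀ T p, TGstar G T p → ∀ J : Finset G.edgeSet, IsMinJoin G T p J →
      ∃! J' : Finset G.edgeSet, J' ∈ CS T p ∧ JoinEquiv G T p J J')
    (hK0 : ∀ T p, TGstar G T p → K0 T p ∈ CS T p) :
    IsMinimalHomGenSet
      ({f : MvPolynomial G.edgeSet K | ∃ e : G.edgeSet, e ≠ l ∧ f = X e ^ 2 - X l ^ 2} ∪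
        {f : MvPolynomial G.edgeSet K | ∃ (T : Finset (Fin n)) (p : ZMod 2),
          TGstar G T p ∧ ∃ J ∈ CS T p, J ≠ K0 T p ∧
            f = tMon K G J - tMon K G (K0 T p)})
      (eulerianIdeal K G) := by
  have hsub (e : G.edgeSet) : (X e ^ 2 - X l ^ 2 : MvPolynomial G.edgeSet K) =
      monomial (Finsupp.single e 2) 1 - monomial (Finsupp.single l 2) 1 := by
    rw [X_pow_eq_monomial, X_pow_eq_monomial]
  have hK0min {T p} (h : TGstar G T p) : IsMinJoin G T p (K0 T p) :=
    hCSmem T p h _ (hK0 T p h)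
  have huniq {T p} (h : TGstar G T p) {J J'} (hJ : J ∈ CS T p) (hJ' : J' ∈ CS T p)
      (hJJ' : JoinEquiv G T p J J') : J = J' :=
    (hCSrep T p h J (hCSmem T p h J hJ)).unique ⟨hJ, .refl (hCSmem T p h J hJ)⟩ ⟨hJ', hJJ'⟩
  refine ⟨?_, le_antisymm ?_ ?_, ?_⟩
  · rintro f (⟨e, -, rfl⟩ | ⟨T, p, h, J, hJ, -, rfl⟩)
    · exact ⟨2, (isHomogeneous_X_pow e 2).sub (isHomogeneous_X_pow l 2)⟩
    · have hhom (L : Finset G.edgeSet) : (tMon K G L).IsHomogeneous L.card := by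
        simpa [tMon] using IsHomogeneous.prod L _ (fun _ => 1) fun e _ => isHomogeneous_X K e
      refine ⟨J.card, (hhom J).sub ?_⟩
      rw [(hCSmem T p h J hJ).card_eq (hK0min h)]
      exact hhom _
  · rw [Ideal.span_le]
    rintro f (⟨e, -, rfl⟩ | ⟨T, p, h, J, hJ, -, rfl⟩)
    · rw [hsub]
      exact monomial_sub_monomial_mem_eulerianIdeal K
        (by rw [joinClass_single_two, joinClass_single_two])
    · rw [tMon_eq_monomial, tMon_eq_monomial]
      exact monomial_sub_monomial_mem_eulerianIdeal K
        ((hCSmem T p h J hJ).joinClass_eq (hK0min h))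
  · refine eulerianIdeal_le_of_forall_joinClass (mk_monomial_eq_of_joinClass_eq (l := l) ?_ ?_)
    · intro e
      by_cases he : e = l
      · rw [he]
      · rw [Ideal.Quotient.eq, ← hsub]
        exact Ideal.subset_span (Or.inl ⟨e, he, rfl⟩)
    · intro T p h
      refine ⟨Ideal.Quotient.mk _ (monomial (joinExp (K0 T p)) 1), fun J hJ => ?_⟩
      obtain ⟨J', ⟨hJ', hJJ'⟩, -⟩ := hCSrep T p h J hJ
      refine ⟨J', hJJ', ?_⟩
      by_cases he : J' = K0 T p
      · rw [he]
      · rw [Ideal.Quotient.eq, ← tMon_eq_monomial, ← tMon_eq_monomial]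
        exact Ideal.subset_span (Or.inr ⟨T, p, h, J', hJ', he, rfl⟩)
  · intro f hf hspan
    rcases hf with ⟨e, he, rfl⟩ | ⟨T, p, h, J, hJ, hne, rfl⟩
    · have hmem : (X e ^ 2 - X l ^ 2 : MvPolynomial G.edgeSet K) ∈ eulerianIdeal K G := by
        rw [hsub]
        exact monomial_sub_monomial_mem_eulerianIdeal K
          (by rw [joinClass_single_two, joinClass_single_two])
      have hsingle (e' : G.edgeSet) (he' : e' ≠ e) (a : G.edgeSet →₀ ℕ) :
          a + Finsupp.single e' 2 ≠ Finsupp.single e 2 := fun h => by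
        have := DFunLike.congr_fun h e'
        simp [he'.symm] at this
      have hcard (a : G.edgeSet →₀ ℕ) (L : Finset G.edgeSet)
          (h : a + joinExp L = Finsupp.single e 2) : L.card ≤ 1 := by
        refine (Finset.card_le_card (t := {e}) fun e' he' => ?_).trans_eq (Finset.card_singleton e)
        by_contra hne
        have := DFunLike.congr_fun h e'
        rw [Finset.mem_singleton] at hne
        simp [Ne.symm hne, joinExp_apply, he'] at this
      rw [← hspan, hsub] at hmem
      refine notMem_span_of_separated {Finsupp.single e 2} ?_ rfl ?_ hmem
      · rintro g ⟨⟨e', -, rfl⟩ | ⟨T, p, h, J, hJ, hne, rfl⟩, hg⟩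
        · refine ⟨_, _, hsub e', fun a => iff_of_false (hsingle e' ?_ a) (hsingle l he.symm a)⟩
          rintro rfl
          exact hg (hsub e')
        · have hcl := (hCSmem T p h J hJ).joinClass_eq (hK0min h)
          rw [tMon_eq_monomial, tMon_eq_monomial]
          refine ⟨_, _, rfl, fun a => iff_of_false (fun ha => ?_) fun ha => ?_⟩
          · exact hne (eq_of_joinClass_eq_of_card_le_one hcl (hcard a J ha))
          · exact hne (eq_of_joinClass_eq_of_card_le_one hcl.symm (hcard a _ ha)).symm
      · simpa using hsingle l he.symm 0
    · have hmem : tMon K G J - tMon K G (K0 T p) ∈ eulerianIdeal K G := by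
        rw [tMon_eq_monomial, tMon_eq_monomial]
        exact monomial_sub_monomial_mem_eulerianIdeal K
          ((hCSmem T p h J hJ).joinClass_eq (hK0min h))
      have hsingle (e : G.edgeSet) (a : G.edgeSet →₀ ℕ) :
          ¬ ∃ L, JoinEquiv G T p L J ∧ a + Finsupp.single e 2 = joinExp L := by
        rintro ⟨L, -, hL⟩
        have := DFunLike.congr_fun hL e
        rw [Finsupp.add_apply, Finsupp.single_eq_same, joinExp_apply] at this
        split_ifs at this; omega
      rw [← hspan, tMon_eq_monomial, tMon_eq_monomial] at hmem
      refine notMem_span_of_separated {m | ∃ L, JoinEquiv G T p L J ∧ m = joinExp L} ?_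
        ⟨J, .refl (hCSmem T p h J hJ), rfl⟩ ?_ hmem
      · rintro g ⟨⟨e, -, rfl⟩ | ⟨T', p', h', J', hJ', hne', rfl⟩, hg⟩
        · exact ⟨_, _, hsub e, fun a => iff_of_false (hsingle e a) (hsingle l a)⟩
        · have hmin' := hCSmem T' p' h' J' hJ'
          have hcl := hmin'.joinClass_eq (hK0min h')
          rw [tMon_eq_monomial, tMon_eq_monomial] at hg ⊢
          refine ⟨_, _, rfl, fun a => ?_⟩
          by_cases ha : a = 0
          · subst ha
            simp only [zero_add]
            refine iff_of_false ?_ ?_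
            · rintro ⟨L, hL, hLJ'⟩
              obtain rfl := joinExp_injective hLJ'
              obtain ⟨rfl, rfl⟩ := hL.isMinJoin_left.1.unique hmin'.1
              obtain rfl := huniq h hJ' hJ hL
              exact hg rfl
            · rintro ⟨L, hL, hLK⟩
              obtain rfl := joinExp_injective hLK
              obtain ⟨rfl, rfl⟩ := hL.isMinJoin_left.1.unique (hK0min h').1
              exact hne (huniq h (hK0 _ _ h) hJ hL).symm
          · exact ⟨JoinEquiv.exists_add_joinExp hcl ha, JoinEquiv.exists_add_joinExp hcl.symm ha⟩
      · rintro ⟨L, hL, hLK⟩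
        obtain rfl := joinExp_injective hLK
        exact hne (huniq h (hK0 _ _ h) hJ hL).symm
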